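/- Let K = ℂ, q ∈ (0,1), p a q²-separable polynomial with real coefficients, α₀ ∈ ℝ, conj(α₋) = q·α₊, and let β₊, β₋ ∈ ℂ with conj(β₋)/β₊ a negative real number, and let ν ∈ ℂ satisfy ν² = −q³·conj(β₋)/β₊. Define on the spinor module S = A(p;q)₋₁ ⊕ A(p;q)₁ the Dirac operator D(a, b) = (β₊q⁻¹∂₊(b), β₋q∂₋(a)), the grading γ(a, b) = (a, −b), and the conjugate-linear map J(a, b) = (−ν⁻¹b*, νa*). Then: (i) J² = −id; (ii) J ∘ γ = −γ ∘ J; (iii) J ∘ D = D ∘ J; (iv) for all u, v ∈ B := A(p;q)₀, [L_u, J ∘ L_v ∘ J] = 0, where L_u denotes left multiplication by u on S; (v) for all u, v ∈ B, [[D, L_u], J ∘ L_v ∘ J] = 0. In other words, J is a real structure for D of KO-dimension two. -/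

import Mathlib

noncomputable section

open Polynomial
open scoped Classical

namespace GWAPaper

variable (K : Type) [Field K]

/-- Defining relations of the generalized Weyl algebra `A(p;q)`; the generators are
indexed by `Fin 4` with `0 ↦ x₊`, `1 ↦ x₋`, `2 ↦ z₊`, `3 ↦ z₋`. -/
inductive GWARel (q : K) (p : K[X]) :
    FreeAlgebra K (Fin 4) → FreeAlgebra K (Fin 4) → Prop
  | zz : GWARel q p (FreeAlgebra.ι K (2 : Fin 4) * FreeAlgebra.ι K (3 : Fin 4))
      (FreeAlgebra.ι K (3 : Fin 4) * FreeAlgebra.ι K (2 : Fin 4))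
  | xpzp : GWARel q p (FreeAlgebra.ι K (0 : Fin 4) * FreeAlgebra.ι K (2 : Fin 4))
      (q⁻¹ • (FreeAlgebra.ι K (2 : Fin 4) * FreeAlgebra.ι K (0 : Fin 4)))
  | xpzm : GWARel q p (FreeAlgebra.ι K (0 : Fin 4) * FreeAlgebra.ι K (3 : Fin 4))
      (q⁻¹ • (FreeAlgebra.ι K (3 : Fin 4) * FreeAlgebra.ι K (0 : Fin 4)))
  | xmzp : GWARel q p (FreeAlgebra.ι K (1 : Fin 4) * FreeAlgebra.ι K (2 : Fin 4))
      (q • (FreeAlgebra.ι K (2 : Fin 4) * FreeAlgebra.ι K (1 : Fin 4)))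
  | xmzm : GWARel q p (FreeAlgebra.ι K (1 : Fin 4) * FreeAlgebra.ι K (3 : Fin 4))
      (q • (FreeAlgebra.ι K (3 : Fin 4) * FreeAlgebra.ι K (1 : Fin 4)))
  | xpxm : GWARel q p (FreeAlgebra.ι K (0 : Fin 4) * FreeAlgebra.ι K (1 : Fin 4))
      (Polynomial.aeval (FreeAlgebra.ι K (2 : Fin 4) * FreeAlgebra.ι K (3 : Fin 4)) p)
  | xmxp : GWARel q p (FreeAlgebra.ι K (1 : Fin 4) * FreeAlgebra.ι K (0 : Fin 4))
      (Polynomial.aeval ((q ^ 2 : K) • (FreeAlgebra.ι K (3 : Fin 4) * FreeAlgebra.ι K (2 : Fin 4))) p)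

/-- The generalized Weyl algebra `A(p;q)`. -/
abbrev GWA (q : K) (p : K[X]) : Type := RingQuot (GWARel K q p)

/-- The images of the four generators in `A(p;q)`. -/
def gwaGen (q : K) (p : K[X]) (i : Fin 4) : GWA K q p :=
  RingQuot.mkAlgHom K (GWARel K q p) (FreeAlgebra.ι K i)

/-- The generator `x₊`. -/
def xp (q : K) (p : K[X]) : GWA K q p := gwaGen K q p 0
/-- The generator `x₋`. -/
def xm (q : K) (p : K[X]) : GWA K q p := gwaGen K q p 1
/-- The generator `z₊`. -/
def zp (q : K) (p : K[X]) : GWA K q p := gwaGen K q p 2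
/-- The generator `z₋`. -/
def zm (q : K) (p : K[X]) : GWA K q p := gwaGen K q p 3

/-- ℤ-degrees of the generators: `deg x₊ = deg z₊ = 1`, `deg x₋ = deg z₋ = -1`. -/
def gwaWt : Fin 4 → ℤ := ![1, -1, 1, -1]

/-- The total degree of a word in the generators. -/
def wordDeg (w : List (Fin 4)) : ℤ := (w.map gwaWt).sum

/-- The product in `A(p;q)` of the letters of a word. -/
def wordVal (q : K) (p : K[X]) (w : List (Fin 4)) : GWA K q p :=
  (w.map (gwaGen K q p)).prod

/-- The degree-`n` homogeneous component of the ℤ-graded algebra `A(p;q)`: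
the `K`-linear span of the values of all words of total degree `n`. -/
def component (q : K) (p : K[X]) (n : ℤ) : Submodule K (GWA K q p) :=
  Submodule.span K {a | ∃ w : List (Fin 4), wordDeg w = n ∧ wordVal K q p w = a}

/-- The `q²`-derivative `p_{q²}` of a polynomial `p`, equal to
`(p(q²z) - p(z))/((q²-1)z)` if `q² ≠ 1` and to `p'` if `q² = 1`. -/
def qDeriv (q : K) (p : K[X]) : K[X] :=
  if q ^ 2 = 1 then derivative p
  else (p.comp (C (q ^ 2) * X) - p) / (C (q ^ 2 - 1) * X)

/-- The polynomial `c(z) = q·p_{q²}(z)`. -/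
def cPoly (q : K) (p : K[X]) : K[X] := C q * qDeriv K q p

/-- `p` is `q²`-separable: `p(z)` is coprime with `z·p_{q²}(z)`. -/
def QSeparable (q : K) (p : K[X]) : Prop := IsCoprime p (X * qDeriv K q p)

/-- The real-structure operator `J(a,b) = (−ν⁻¹b*, νa*)` on the spinor module. -/
def Jop (q : ℝ) (p : Polynomial ℝ)
    (st : GWA ℂ (q : ℂ) (p.map (algebraMap ℝ ℂ)) → GWA ℂ (q : ℂ) (p.map (algebraMap ℝ ℂ))) (ν : ℂ)
    (s : GWA ℂ (q : ℂ) (p.map (algebraMap ℝ ℂ)) × GWA ℂ (q : ℂ) (p.map (algebraMap ℝ ℂ))) :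
    GWA ℂ (q : ℂ) (p.map (algebraMap ℝ ℂ)) × GWA ℂ (q : ℂ) (p.map (algebraMap ℝ ℂ)) :=
  ((-ν⁻¹) • st s.2, ν • st s.1)

/-- The Dirac operator `D(a,b) = (β₊q⁻¹∂₊(b), β₋q∂₋(a))` on the spinor module. -/
def Dop (q : ℝ) (p : Polynomial ℝ)
    (Dm Dp : GWA ℂ (q : ℂ) (p.map (algebraMap ℝ ℂ)) →ₗ[ℂ] GWA ℂ (q : ℂ) (p.map (algebraMap ℝ ℂ))) (βp βm : ℂ)
    (s : GWA ℂ (q : ℂ) (p.map (algebraMap ℝ ℂ)) × GWA ℂ (q : ℂ) (p.map (algebraMap ℝ ℂ))) :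
    GWA ℂ (q : ℂ) (p.map (algebraMap ℝ ℂ)) × GWA ℂ (q : ℂ) (p.map (algebraMap ℝ ℂ)) :=
  ((βp * (q : ℂ)⁻¹) • Dp s.2, (βm * (q : ℂ)) • Dm s.1)

/-- The grading operator `γ(a,b) = (a,−b)` on the spinor module. -/
def gammaOp (q : ℝ) (p : Polynomial ℝ)
    (s : GWA ℂ (q : ℂ) (p.map (algebraMap ℝ ℂ)) × GWA ℂ (q : ℂ) (p.map (algebraMap ℝ ℂ))) :
    GWA ℂ (q : ℂ) (p.map (algebraMap ℝ ℂ)) × GWA ℂ (q : ℂ) (p.map (algebraMap ℝ ℂ)) :=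
  (s.1, -s.2)

/-- Left multiplication `L_u(a,b) = (ua, ub)` on the spinor module. -/
def Lop (q : ℝ) (p : Polynomial ℝ) (u : GWA ℂ (q : ℂ) (p.map (algebraMap ℝ ℂ)))
    (s : GWA ℂ (q : ℂ) (p.map (algebraMap ℝ ℂ)) × GWA ℂ (q : ℂ) (p.map (algebraMap ℝ ℂ))) :
    GWA ℂ (q : ℂ) (p.map (algebraMap ℝ ℂ)) × GWA ℂ (q : ℂ) (p.map (algebraMap ℝ ℂ)) :=
  (u * s.1, u * s.2)


section Involution

variable {A : Type*}

lemma antiinvolution_one [Monoid A] {st : A → A} (hmul : ∀ a b, st (a * b) = st b * st a)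
    (hinvol : ∀ a, st (st a) = a) : st 1 = 1 := by
  have h := hmul 1 (st 1)
  rwa [one_mul, hinvol, one_mul, eq_comm] at h

variable [Semiring A] [Algebra ℂ A]

lemma antiinvolution_aeval_map_real {st : A → A} (hadd : ∀ a b, st (a + b) = st a + st b)
    (hsmul : ∀ (k : ℂ) a, st (k • a) = (starRingEnd ℂ) k • st a)
    (hmul : ∀ a b, st (a * b) = st b * st a) (hinvol : ∀ a, st (st a) = a)
    {z : A} (hz : st z = z) (f : ℝ[X]) :
    st (aeval z (f.map (algebraMap ℝ ℂ))) = aeval z (f.map (algebraMap ℝ ℂ)) := by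
  have hpow : ∀ n : ℕ, st (z ^ n) = z ^ n := by
    intro n
    induction n with
    | zero => simpa using antiinvolution_one hmul hinvol
    | succ n ih => rw [pow_succ, hmul, ih, hz, ← pow_succ', pow_succ]
  induction f using Polynomial.induction_on' with
  | add f g hf hg => rw [Polynomial.map_add, map_add, hadd, hf, hg]
  | monomial n r =>
    rw [Polynomial.map_monomial, aeval_monomial, ← Algebra.smul_def, hsmul, hpow]
    simp

lemma commute_aeval {y z : A} (h : Commute y z) (f : ℂ[X]) : Commute y (aeval z f) := by
  induction f using Polynomial.induction_on' with
  | add f g hf hg => rw [map_add]; exact hf.add_right hg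
  | monomial n r =>
    rw [aeval_monomial, ← Algebra.smul_def]
    exact (h.pow_right n).smul_right r

end Involution

lemma qDeriv_map (q : ℝ) (f : ℝ[X]) :
    qDeriv ℂ (q : ℂ) (f.map (algebraMap ℝ ℂ)) = (qDeriv ℝ q f).map (algebraMap ℝ ℂ) := by
  have h : (q : ℂ) ^ 2 = 1 ↔ q ^ 2 = 1 := by norm_cast
  unfold qDeriv
  split_ifs with h1 h2 h2
  · exact derivative_map f _
  · exact absurd (h.1 h1) h2
  · exact absurd (h.2 h2) h1
  · simp [Polynomial.map_div, Polynomial.map_comp]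

lemma cPoly_map (q : ℝ) (f : ℝ[X]) :
    cPoly ℂ (q : ℂ) (f.map (algebraMap ℝ ℂ)) = (cPoly ℝ q f).map (algebraMap ℝ ℂ) := by
  simp [cPoly, qDeriv_map]

section Words

variable {K}
variable {q : K} {p : K[X]}

/- The negation of `RingQuot` is not reducibly equal to the one derived from its ring structure,
so the general lemmas do not rewrite with it; the following restatements do. -/

lemma gwa_mul_neg (a b : GWA K q p) : a * -b = -(a * b) := mul_neg a b

lemma gwa_neg_smul (k : K) (a : GWA K q p) : -k • a = -(k • a) := neg_smul k a

lemma gwa_smul_neg (k : K) (a : GWA K q p) : k • -a = -(k • a) := smul_neg k a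

lemma gwa_neg_neg (a : GWA K q p) : - -a = a := neg_neg a

lemma gwa_map_neg (f : GWA K q p →ₗ[K] GWA K q p) (a : GWA K q p) : f (-a) = -f a :=
  map_neg f a

lemma gwa_add_sub_cancel_right (a b : GWA K q p) : a + b - b = a := add_sub_cancel_right a b

lemma zp_mul_zm_comm : zp K q p * zm K q p = zm K q p * zp K q p := by
  have h := RingQuot.mkAlgHom_rel K (GWARel.zz (q := q) (p := p))
  rwa [map_mul, map_mul] at h

lemma wordVal_cons (i : Fin 4) (w : List (Fin 4)) :
    wordVal K q p (i :: w) = gwaGen K q p i * wordVal K q p w := by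
  simp [wordVal]

lemma wordDeg_cons (i : Fin 4) (w : List (Fin 4)) :
    wordDeg (i :: w) = gwaWt i + wordDeg w := by
  simp [wordDeg]

lemma wordVal_mem_component (w : List (Fin 4)) :
    wordVal K q p w ∈ component K q p (wordDeg w) :=
  Submodule.subset_span ⟨w, rfl, rfl⟩

lemma gwaGen_mem_component (i : Fin 4) :
    gwaGen K q p i ∈ component K q p (gwaWt i) :=
  Submodule.subset_span ⟨[i], by simp [wordDeg], by simp [wordVal]⟩

/-- The permutation of the generators induced by the involution. -/
def starIdx : Fin 4 → Fin 4 := ![1, 0, 3, 2]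

lemma gwaWt_starIdx (i : Fin 4) : gwaWt (starIdx i) = -gwaWt i := by
  fin_cases i <;> rfl

end Words

section Star

variable {q : ℂ} {p : ℂ[X]} {st : GWA ℂ q p → GWA ℂ q p}

lemma star_mem_component (hadd : ∀ a b, st (a + b) = st a + st b)
    (hsmul : ∀ (k : ℂ) (a : GWA ℂ q p), st (k • a) = (starRingEnd ℂ) k • st a)
    (hmul : ∀ a b, st (a * b) = st b * st a) (hinvol : ∀ a, st (st a) = a)
    (hgen : ∀ i, st (gwaGen ℂ q p i) = gwaGen ℂ q p (starIdx i))
    {n : ℤ} {a : GWA ℂ q p} (ha : a ∈ component ℂ q p n) :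
    st a ∈ component ℂ q p (-n) := by
  have hword : ∀ w : List (Fin 4),
      st (wordVal ℂ q p w) = wordVal ℂ q p (w.map starIdx).reverse := by
    intro w
    induction w with
    | nil => simpa [wordVal] using antiinvolution_one hmul hinvol
    | cons i w ih => rw [wordVal_cons, hmul, ih, hgen]; simp [wordVal]
  have hdeg : ∀ w : List (Fin 4), wordDeg (w.map starIdx).reverse = -wordDeg w := by
    intro w
    induction w with
    | nil => simp [wordDeg]
    | cons i w ih =>
      rw [wordDeg_cons, neg_add, ← ih, ← gwaWt_starIdx]
      simp [wordDeg, add_comm]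
  induction ha using Submodule.span_induction with
  | mem x hx =>
    obtain ⟨w, rfl, rfl⟩ := hx
    rw [hword, ← hdeg]
    exact wordVal_mem_component _
  | zero =>
    have h0 : st 0 = 0 := by simpa using hsmul 0 0
    rw [h0]
    exact zero_mem _
  | add x y _ _ hx hy => rw [hadd]; exact add_mem hx hy
  | smul k x _ hx => rw [hsmul]; exact Submodule.smul_mem _ _ hx

/-- Skew derivations that are star-related on the generators are star-related on every
homogeneous component, up to a power of `q`. -/
lemma star_skewDerivation (hq : q ≠ 0) (hqr : (starRingEnd ℂ) q = q)
    (hadd : ∀ a b, st (a + b) = st a + st b)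
    (hsmul : ∀ (k : ℂ) (a : GWA ℂ q p), st (k • a) = (starRingEnd ℂ) k • st a)
    (hmul : ∀ a b, st (a * b) = st b * st a) (hinvol : ∀ a, st (st a) = a)
    (hgen : ∀ i, st (gwaGen ℂ q p i) = gwaGen ℂ q p (starIdx i))
    {σ : GWA ℂ q p ≃ₐ[ℂ] GWA ℂ q p}
    (hσ : ∀ (n : ℤ) (a : GWA ℂ q p), a ∈ component ℂ q p n → σ a = q ^ n • a)
    {Dm Dp : GWA ℂ q p →ₗ[ℂ] GWA ℂ q p}
    (hDm : ∀ a b, Dm (a * b) = Dm a * σ b + a * Dm b)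
    (hDp : ∀ a b, Dp (a * b) = Dp a * σ b + a * Dp b)
    (hD : ∀ i, st (Dm (gwaGen ℂ q p i)) =
      q ^ (gwaWt i + 2) • Dp (gwaGen ℂ q p (starIdx i)))
    {n : ℤ} {a : GWA ℂ q p} (ha : a ∈ component ℂ q p n) :
    st (Dm a) = q ^ (n + 2) • Dp (st a) := by
  have h0 : st 0 = 0 := by simpa using hsmul 0 0
  have hm1 : Dm 1 = 0 := by simpa using hDm 1 1
  have hp1 : Dp 1 = 0 := by simpa using hDp 1 1
  have hword : ∀ w : List (Fin 4), st (Dm (wordVal ℂ q p w)) =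
      q ^ (wordDeg w + 2) • Dp (st (wordVal ℂ q p w)) := by
    intro w
    induction w with
    | nil => simp [wordVal, antiinvolution_one hmul hinvol, hm1, hp1, h0]
    | cons i w ih =>
      have hσi := hσ _ _ (gwaGen_mem_component (q := q) (p := p) (starIdx i))
      rw [wordVal_cons, hDm, hadd, hmul, hmul, hσ _ _ (wordVal_mem_component w), hsmul,
        ih, hD, hmul, hgen, hDp, hσi, gwaWt_starIdx, wordDeg_cons, map_zpow₀, hqr,
        smul_add, mul_smul_comm, smul_mul_assoc, smul_mul_assoc, mul_smul_comm,
        smul_smul, smul_smul, ← zpow_add₀ hq, ← zpow_add₀ hq, add_comm]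
      congr 3 <;> ring
  induction ha using Submodule.span_induction with
  | mem x hx =>
    obtain ⟨w, rfl, rfl⟩ := hx
    exact hword w
  | zero => simp [h0]
  | add x y _ _ hx hy => rw [map_add, hadd, hx, hy, hadd, map_add, smul_add]
  | smul k x _ hx => rw [map_smul, hsmul, hx, hsmul, map_smul, smul_comm]

end Star

/-- `J(a,b) = (−ν⁻¹b*, νa*)` is a real structure of KO-dimension two
for the Dirac operator `D`: `J² = −id`, `J∘γ = −γ∘J`, `J∘D = D∘J`, and the order-zero
and order-one conditions hold. -/
theorem real_structure_KO_dimension_two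
    (q : ℝ) (hq0 : 0 < q) (hq1 : q < 1) (p : Polynomial ℝ)
    (hsep : QSeparable ℂ (q : ℂ) (p.map (algebraMap ℝ ℂ)))
    (α0 : ℝ) (αm αp : ℂ) (hαm : αm ≠ 0) (hαp : αp ≠ 0)
    (hα : (starRingEnd ℂ) αm = (q : ℂ) * αp)
    (σm : GWA ℂ (q : ℂ) (p.map (algebraMap ℝ ℂ)) ≃ₐ[ℂ] GWA ℂ (q : ℂ) (p.map (algebraMap ℝ ℂ)))
    (hσm : ∀ (n : ℤ) (a : GWA ℂ (q : ℂ) (p.map (algebraMap ℝ ℂ))), a ∈ component ℂ (q : ℂ) (p.map (algebraMap ℝ ℂ)) n → σm a = (q : ℂ) ^ n • a)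
    (Dm Dp : GWA ℂ (q : ℂ) (p.map (algebraMap ℝ ℂ)) →ₗ[ℂ] GWA ℂ (q : ℂ) (p.map (algebraMap ℝ ℂ)))
    (hDmleib : ∀ a b, Dm (a * b) = Dm a * σm b + a * Dm b)
    (hDmxp : Dm (xp ℂ (q : ℂ) (p.map (algebraMap ℝ ℂ))) = 0)
    (hDmzp : Dm (zp ℂ (q : ℂ) (p.map (algebraMap ℝ ℂ))) = 0)
    (hDmxm : Dm (xm ℂ (q : ℂ) (p.map (algebraMap ℝ ℂ))) = αm • (aeval (zp ℂ (q : ℂ) (p.map (algebraMap ℝ ℂ)) * zm ℂ (q : ℂ) (p.map (algebraMap ℝ ℂ))) (cPoly ℂ (q : ℂ) (p.map (algebraMap ℝ ℂ))) * zp ℂ (q : ℂ) (p.map (algebraMap ℝ ℂ))))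
    (hDmzm : Dm (zm ℂ (q : ℂ) (p.map (algebraMap ℝ ℂ))) = αm • xp ℂ (q : ℂ) (p.map (algebraMap ℝ ℂ)))
    (hDpleib : ∀ a b, Dp (a * b) = Dp a * σm b + a * Dp b)
    (hDpxm : Dp (xm ℂ (q : ℂ) (p.map (algebraMap ℝ ℂ))) = 0)
    (hDpzm : Dp (zm ℂ (q : ℂ) (p.map (algebraMap ℝ ℂ))) = 0)
    (hDpxp : Dp (xp ℂ (q : ℂ) (p.map (algebraMap ℝ ℂ))) = αp • (aeval (zp ℂ (q : ℂ) (p.map (algebraMap ℝ ℂ)) * zm ℂ (q : ℂ) (p.map (algebraMap ℝ ℂ))) (cPoly ℂ (q : ℂ) (p.map (algebraMap ℝ ℂ))) * zm ℂ (q : ℂ) (p.map (algebraMap ℝ ℂ))))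
    (hDpzp : Dp (zp ℂ (q : ℂ) (p.map (algebraMap ℝ ℂ))) = αp • xm ℂ (q : ℂ) (p.map (algebraMap ℝ ℂ)))
    (st : GWA ℂ (q : ℂ) (p.map (algebraMap ℝ ℂ)) → GWA ℂ (q : ℂ) (p.map (algebraMap ℝ ℂ)))
    (hst_add : ∀ a b, st (a + b) = st a + st b)
    (hst_smul : ∀ (k : ℂ) (a : GWA ℂ (q : ℂ) (p.map (algebraMap ℝ ℂ))), st (k • a) = (starRingEnd ℂ) k • st a)
    (hst_mul : ∀ a b, st (a * b) = st b * st a)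
    (hst_invol : ∀ a, st (st a) = a)
    (hst_zm : st (zm ℂ (q : ℂ) (p.map (algebraMap ℝ ℂ))) = zp ℂ (q : ℂ) (p.map (algebraMap ℝ ℂ)))
    (hst_zp : st (zp ℂ (q : ℂ) (p.map (algebraMap ℝ ℂ))) = zm ℂ (q : ℂ) (p.map (algebraMap ℝ ℂ)))
    (hst_xm : st (xm ℂ (q : ℂ) (p.map (algebraMap ℝ ℂ))) = xp ℂ (q : ℂ) (p.map (algebraMap ℝ ℂ)))
    (hst_xp : st (xp ℂ (q : ℂ) (p.map (algebraMap ℝ ℂ))) = xm ℂ (q : ℂ) (p.map (algebraMap ℝ ℂ)))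
    (βp βm ν : ℂ)
    (hβ : ∃ r : ℝ, r < 0 ∧ (starRingEnd ℂ) βm / βp = (r : ℂ))
    (hν : ν ^ 2 = -((q : ℂ) ^ 3) * ((starRingEnd ℂ) βm / βp)) :
    ∀ a ∈ component ℂ (q : ℂ) (p.map (algebraMap ℝ ℂ)) (-1), ∀ b ∈ component ℂ (q : ℂ) (p.map (algebraMap ℝ ℂ)) 1,
      (Jop q p st ν (Jop q p st ν (a, b)) = (-a, -b)) ∧
      (Jop q p st ν (gammaOp q p (a, b)) = -gammaOp q p (Jop q p st ν (a, b))) ∧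
      (Jop q p st ν (Dop q p Dm Dp βp βm (a, b)) = Dop q p Dm Dp βp βm (Jop q p st ν (a, b))) ∧
      (∀ u ∈ component ℂ (q : ℂ) (p.map (algebraMap ℝ ℂ)) 0, ∀ v ∈ component ℂ (q : ℂ) (p.map (algebraMap ℝ ℂ)) 0,
        Lop q p u (Jop q p st ν (Lop q p v (Jop q p st ν (a, b))))
          = Jop q p st ν (Lop q p v (Jop q p st ν (Lop q p u (a, b))))) ∧
      (∀ u ∈ component ℂ (q : ℂ) (p.map (algebraMap ℝ ℂ)) 0, ∀ v ∈ component ℂ (q : ℂ) (p.map (algebraMap ℝ ℂ)) 0,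
        Dop q p Dm Dp βp βm (Lop q p u (Jop q p st ν (Lop q p v (Jop q p st ν (a, b)))))
            - Lop q p u (Dop q p Dm Dp βp βm (Jop q p st ν (Lop q p v (Jop q p st ν (a, b)))))
          = Jop q p st ν (Lop q p v (Jop q p st ν
              (Dop q p Dm Dp βp βm (Lop q p u (a, b)) - Lop q p u (Dop q p Dm Dp βp βm (a, b)))))) := by
  obtain ⟨r, hr, hβr⟩ := hβ
  have hq : (q : ℂ) ≠ 0 := by exact_mod_cast hq0.ne'
  have hqr : (starRingEnd ℂ) (q : ℂ) = q := Complex.conj_ofReal q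
  rw [hβr] at hν
  have hβp : βp ≠ 0 := by
    rintro rfl
    rw [div_zero] at hβr
    exact hr.ne (by exact_mod_cast hβr.symm)
  have hβm : (starRingEnd ℂ) βm = r * βp := (div_eq_iff hβp).1 hβr
  have hβm' : βm = r * (starRingEnd ℂ) βp := by
    have h := congrArg (starRingEnd ℂ) hβm
    simpa using h
  obtain ⟨s, rfl⟩ : ∃ s : ℝ, (s : ℂ) = ν := by
    have hpos : 0 ≤ -(q ^ 3 * r) := by
      have := mul_pos_of_neg_of_neg (neg_neg_of_pos (pow_pos hq0 3)) hr
      linarith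
    have h : ν ^ 2 = ((√(-(q ^ 3 * r)) : ℝ) : ℂ) ^ 2 := by
      rw [← Complex.ofReal_pow, Real.sq_sqrt hpos, hν]
      push_cast
      ring
    rcases sq_eq_sq_iff_eq_or_eq_neg.1 h with h | h
    · exact ⟨_, h.symm⟩
    · exact ⟨-√(-(q ^ 3 * r)), by rw [h]; push_cast; rfl⟩
  have hs : (s : ℂ) ≠ 0 := by
    intro h
    rw [h, zero_pow two_ne_zero, eq_comm, mul_eq_zero, neg_eq_zero] at hν
    rcases hν with hν | hν
    · exact pow_ne_zero 3 hq hν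
    · exact hr.ne (by exact_mod_cast hν)
  have hsr : (starRingEnd ℂ) (s : ℂ) = s := Complex.conj_ofReal s
  have hst_zero : st 0 = 0 := by simpa using hst_smul 0 0
  have hst_neg : ∀ a, st (-a) = -st a := fun a => by
    rw [← one_smul ℂ a, ← gwa_neg_smul, hst_smul, hst_smul, map_neg, gwa_neg_smul]
  have hgen : ∀ i, st (gwaGen ℂ (q : ℂ) (p.map (algebraMap ℝ ℂ)) i) =
      gwaGen ℂ (q : ℂ) (p.map (algebraMap ℝ ℂ)) (starIdx i) := by
    intro i
    fin_cases i
    exacts [hst_xp, hst_xm, hst_zp, hst_zm]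
  have hc : st (aeval (zp ℂ (q : ℂ) (p.map (algebraMap ℝ ℂ)) *
        zm ℂ (q : ℂ) (p.map (algebraMap ℝ ℂ))) (cPoly ℂ (q : ℂ) (p.map (algebraMap ℝ ℂ))) *
          zp ℂ (q : ℂ) (p.map (algebraMap ℝ ℂ))) =
      aeval (zp ℂ (q : ℂ) (p.map (algebraMap ℝ ℂ)) *
        zm ℂ (q : ℂ) (p.map (algebraMap ℝ ℂ))) (cPoly ℂ (q : ℂ) (p.map (algebraMap ℝ ℂ))) *
          zm ℂ (q : ℂ) (p.map (algebraMap ℝ ℂ)) := by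
    rw [hst_mul, hst_zp, cPoly_map, antiinvolution_aeval_map_real hst_add hst_smul hst_mul
      hst_invol (by rw [hst_mul, hst_zp, hst_zm])]
    refine commute_aeval ?_ _
    have h : Commute (zm ℂ (q : ℂ) (p.map (algebraMap ℝ ℂ)))
      (zp ℂ (q : ℂ) (p.map (algebraMap ℝ ℂ))) := zp_mul_zm_comm.symm
    exact h.mul_right (Commute.refl _)
  have hDgen : ∀ i, st (Dm (gwaGen ℂ (q : ℂ) (p.map (algebraMap ℝ ℂ)) i)) =
      (q : ℂ) ^ (gwaWt i + 2) •
        Dp (gwaGen ℂ (q : ℂ) (p.map (algebraMap ℝ ℂ)) (starIdx i)) := by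
    have hwt : (q : ℂ) ^ ((-1 : ℤ) + 2) = q := by norm_num
    intro i
    fin_cases i
    · change st (Dm (xp _ _ _)) = _ • Dp (xm _ _ _)
      rw [hDmxp, hDpxm, hst_zero, smul_zero]
    · change st (Dm (xm _ _ _)) = (q : ℂ) ^ ((-1 : ℤ) + 2) • Dp (xp _ _ _)
      rw [hDmxm, hDpxp, hst_smul, hc, hα, hwt, mul_smul]
    · change st (Dm (zp _ _ _)) = _ • Dp (zm _ _ _)
      rw [hDmzp, hDpzm, hst_zero, smul_zero]
    · change st (Dm (zm _ _ _)) = (q : ℂ) ^ ((-1 : ℤ) + 2) • Dp (zp _ _ _)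
      rw [hDmzm, hDpzp, hst_smul, hst_xp, hα, hwt, mul_smul]
  have hDst : ∀ a ∈ component ℂ (q : ℂ) (p.map (algebraMap ℝ ℂ)) (-1),
      st (Dm a) = (q : ℂ) • Dp (st a) := by
    intro a ha
    have h := star_skewDerivation hq hqr hst_add hst_smul hst_mul hst_invol hgen hσm
      hDmleib hDpleib hDgen ha
    rwa [show (-1 : ℤ) + 2 = 1 by norm_num, zpow_one] at h
  have hJLJ : ∀ v a b, Jop q p st s (Lop q p v (Jop q p st s (a, b))) =
      (-(a * st v), -(b * st v)) := by
    intro v a b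
    simp only [Jop, Lop, mul_smul_comm, gwa_neg_smul, gwa_mul_neg,
      gwa_smul_neg, hst_neg, hst_smul, hst_mul, hst_invol, smul_smul,
      map_inv₀, hsr, neg_mul, inv_mul_cancel₀ hs, mul_inv_cancel₀ hs, one_smul]
  intro a ha b hb
  refine ⟨?_, ?_, ?_, ?_, ?_⟩
  · simp only [Jop, gwa_neg_smul, gwa_smul_neg, hst_neg, hst_smul, hst_invol, smul_smul,
      map_inv₀, hsr, neg_mul, inv_mul_cancel₀ hs, mul_inv_cancel₀ hs, one_smul]
  · simp only [Jop, gammaOp, hst_neg, gwa_smul_neg, gwa_neg_smul, gwa_neg_neg, Prod.neg_mk]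
  · have hb' := hDst _ (star_mem_component hst_add hst_smul hst_mul hst_invol hgen hb)
    rw [hst_invol] at hb'
    have hb'' : Dm (st b) = (q : ℂ) • st (Dp b) := by
      rw [← hst_invol (Dm (st b)), hb', hst_smul, hqr]
    simp only [Jop, Dop, hst_smul, map_smul, hDst a ha, hb'', smul_smul, map_mul, map_inv₀, hqr]
    refine Prod.ext ?_ ?_
    · refine congrArg (· • Dp (st a)) ?_
      rw [hβm]
      field_simp
      rw [hν]
      ring
    · refine congrArg (· • st (Dp b)) ?_
      rw [hβm']
      field_simp
      rw [hν]
      ring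
  · intro u _ v _
    rw [hJLJ]
    change (u * _, u * _) = Jop q p st s (Lop q p v (Jop q p st s (u * a, u * b)))
    rw [hJLJ]
    simp only [gwa_mul_neg, mul_assoc]
  · intro u _ v hv
    have hv' := star_mem_component hst_add hst_smul hst_mul hst_invol hgen hv
    have hσv : σm (st v) = st v := by simpa using hσm _ _ hv'
    have hcomm : ∀ x y, Dop q p Dm Dp βp βm (Lop q p u (x, y)) -
        Lop q p u (Dop q p Dm Dp βp βm (x, y)) =
          ((βp * (q : ℂ)⁻¹) • (Dp u * σm y), (βm * (q : ℂ)) • (Dm u * σm x)) := by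
      intro x y
      simp only [Dop, Lop, hDmleib, hDpleib, smul_add, mul_smul_comm, Prod.mk_sub_mk,
        gwa_add_sub_cancel_right]
    rw [hJLJ, hcomm, hcomm, hJLJ]
    have hσneg : ∀ x, σm (-x) = -σm x := gwa_map_neg σm.toLinearMap
    simp only [hσneg, map_mul, hσv, gwa_mul_neg, gwa_smul_neg, smul_mul_assoc, mul_assoc]

end GWAPaper
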